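/- arXiv:2303.10363 — 2 statements merged into one kernel-verified Lean document; each statement's English description precedes it below -/
import Mathlib

section
/- The boundary ∂Ω₂ = Ω̄₂ ∖ Ω₂ is homeomorphic to the Cantor space ℕ → Bool. -/
open Set MeasureTheory Filter Topology

/-- The binary Cantor space. -/
abbrev CantorC : Type := ℕ → Bool

/-- Finite binary words. -/
abbrev BWord : Type := List Bool

/-- Prepend a finite word to an infinite binary sequence. -/
def wordApp (w : BWord) (x : CantorC) : CantorC := fun n =>
  if h : n < w.length then w.get ⟨n, h⟩ else x (n - w.length)

/-- The cylinder of sequences beginning with the word `w`. -/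
def cyl (w : BWord) : Set CantorC := Set.range (wordApp w)

/-- `J` is a code: both the α-cylinders and the β-cylinders form a partition of the
Cantor space (every point lies in the cylinder of exactly one pair). -/
def IsCode (J : Finset (BWord × BWord)) : Prop :=
  (∀ x : CantorC, ∃! p : BWord × BWord, p ∈ J ∧ x ∈ cyl p.1) ∧
  (∀ x : CantorC, ∃! p : BWord × BWord, p ∈ J ∧ x ∈ cyl p.2)

/-- `J` is order preserving: α ≺ α' lexicographically iff β ≺ β' lexicographically. -/
def OrdPres (J : Finset (BWord × BWord)) : Prop :=
  ∀ p ∈ J, ∀ q ∈ J, (List.Lex (· < ·) p.1 q.1 ↔ List.Lex (· < ·) p.2 q.2)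

/-- The bijection `g` is induced by the code `J` : it maps `β·x` to `α·x`. -/
def InducedBy (J : Finset (BWord × BWord)) (g : Equiv.Perm CantorC) : Prop :=
  ∀ p ∈ J, ∀ x : CantorC, g (wordApp p.2 x) = wordApp p.1 x

/-- `J` is an order-preserving code inducing the bijection `g`. -/
def IsCodeFor (J : Finset (BWord × BWord)) (g : Equiv.Perm CantorC) : Prop :=
  IsCode J ∧ OrdPres J ∧ InducedBy J g

/-- Membership in (the realization on the Cantor space of) Thompson's group `F`. -/
def InF (g : Equiv.Perm CantorC) : Prop := ∃ J, IsCodeFor J g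

/-- The pair `(α, β)` has `|α| ≡ |β| (mod 2)`. -/
def EvenPair (p : BWord × BWord) : Prop := p.1.length % 2 = p.2.length % 2

/-- Membership in the subgroup `H₂` : some order-preserving code for `g` has all
pairs of even length difference. -/
def InH2 (g : Equiv.Perm CantorC) : Prop :=
  ∃ J, IsCodeFor J g ∧ ∀ p ∈ J, EvenPair p

/-- The union of the α-cylinders over pairs of even length difference. -/
def pSet (J : Finset (BWord × BWord)) : Set CantorC :=
  {x | ∃ p ∈ J, EvenPair p ∧ x ∈ cyl p.1}

/-- The union of the β-cylinders over pairs of even length difference. -/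
def eSet (J : Finset (BWord × BWord)) : Set CantorC :=
  {x | ∃ p ∈ J, EvenPair p ∧ x ∈ cyl p.2}

/-- `p_f` : for `f ∈ F` this equals `pSet J` for any (equivalently, every)
order-preserving code `J` for `f`. -/
def pF (g : Equiv.Perm CantorC) : Set CantorC :=
  ⋃ J ∈ {J : Finset (BWord × BWord) | IsCodeFor J g}, pSet J

/-- `E_f` : for `f ∈ F` this equals `eSet J` for any (equivalently, every)
order-preserving code `J` for `f`. -/
def EF (g : Equiv.Perm CantorC) : Set CantorC :=
  ⋃ J ∈ {J : Finset (BWord × BWord) | IsCodeFor J g}, eSet J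

/-- `Ω₂ = {p_f : f ∈ F}`. -/
def Omega2 : Set (Set CantorC) := {p | ∃ g, InF g ∧ pF g = p}

/-- The action `f · p = f(p ∩ E_f) ∪ f((C ∖ p) ∩ (C ∖ E_f))`. -/
def actF (g : Equiv.Perm CantorC) (p : Set CantorC) : Set CantorC :=
  g '' (p ∩ EF g) ∪ g '' (pᶜ ∩ (EF g)ᶜ)

open Classical in
/-- `T(p)` as a Boolean-valued characteristic function: `T(p) w = true` iff the
cylinder of `w` meets `p`. -/
noncomputable def Tb (p : Set CantorC) : BWord → Bool :=
  fun w => if (cyl w ∩ p).Nonempty then true else false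

/-- The embedding `p ↦ (T(p), T(C ∖ p))`. -/
noncomputable def embedT (p : Set CantorC) : (BWord → Bool) × (BWord → Bool) :=
  (Tb p, Tb pᶜ)

/-- `Ω̄₂` : the closure of the image of `Ω₂` under the embedding. -/
noncomputable def OmegaBar : Set ((BWord → Bool) × (BWord → Bool)) :=
  closure (embedT '' Omega2)

@[simp] theorem mem_cyl {w : BWord} {x : CantorC} :
    x ∈ cyl w ↔ ∀ i (h : i < w.length), x i = w[i] := by
  constructor
  · rintro ⟨y, rfl⟩ i h
    simp [wordApp, h]
  · intro H
    refine ⟨fun n => x (n + w.length), ?_⟩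
    funext n
    by_cases h : n < w.length
    · simp [wordApp, h, H n h]
    · simp only [wordApp, h, dite_false]
      congr 1
      omega

theorem wordApp_mem_cyl (w : BWord) (x : CantorC) : wordApp w x ∈ cyl w := ⟨x, rfl⟩

theorem wordApp_append (u v : BWord) (x : CantorC) :
    wordApp (u ++ v) x = wordApp u (wordApp v x) := by
  funext n
  simp only [wordApp, List.length_append, List.get_eq_getElem, List.getElem_append]
  split_ifs <;> first | rfl | omega | (congr 1; omega)

theorem wordApp_injective (w : BWord) : Function.Injective (wordApp w) := by
  intro x y h
  funext n
  have := congrFun h (n + w.length)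
  simpa [wordApp] using this

theorem cyl_append_subset (u v : BWord) : cyl (u ++ v) ⊆ cyl u := by
  rintro _ ⟨x, rfl⟩
  rw [wordApp_append]
  exact wordApp_mem_cyl _ _

theorem cyl_eq_union (w : BWord) : cyl w = cyl (w ++ [false]) ∪ cyl (w ++ [true]) := by
  apply Subset.antisymm
  · rintro _ ⟨x, rfl⟩
    have hx : x = wordApp [x 0] (fun n => x (n + 1)) := by
      funext n
      cases n <;> simp [wordApp]
    rw [hx, ← wordApp_append]
    cases x 0
    · exact Or.inl (wordApp_mem_cyl _ _)
    · exact Or.inr (wordApp_mem_cyl _ _)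
  · exact union_subset (cyl_append_subset _ _) (cyl_append_subset _ _)

/-- If two cylinders share a point, the longer word extends the shorter one. -/
theorem exists_append_of_mem_cyl {u v : BWord} {x : CantorC} (hu : x ∈ cyl u) (hv : x ∈ cyl v)
    (h : u.length ≤ v.length) : ∃ s, v = u ++ s := by
  rw [mem_cyl] at hu hv
  have hp : u <+: v := by
    rw [List.prefix_iff_eq_take]
    apply List.ext_getElem
    · simp [h]
    · intro i h1 h2
      rw [List.getElem_take, ← hu i h1, ← hv i (by omega)]
  obtain ⟨s, hs⟩ := hp
  exact ⟨s, hs.symm⟩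

theorem eq_of_mem_cyl {u v : BWord} {x : CantorC} (hu : x ∈ cyl u) (hv : x ∈ cyl v)
    (h : u.length = v.length) : u = v := by
  obtain ⟨s, rfl⟩ := exists_append_of_mem_cyl hu hv h.le
  rw [List.length_append, left_eq_add, List.length_eq_zero_iff] at h
  rw [h, List.append_nil]

theorem length_le_of_wordApp_eq {u v : BWord} (h : ∀ x, wordApp u x = wordApp v x) :
    v.length ≤ u.length := by
  by_contra! hlt
  have h0 := congrFun (h fun _ => false) u.length
  have h1 := congrFun (h fun _ => true) u.length
  simp only [wordApp, lt_irrefl, dite_false, hlt, dite_true] at h0 h1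
  exact Bool.false_ne_true (h0.trans h1.symm)

/-- The sign of a pair only depends on the bijection and on a point of the `α`-cylinder. -/
theorem evenPair_of_evenPair {J J' : Finset (BWord × BWord)} {g : Equiv.Perm CantorC}
    (hJ : InducedBy J g) (hJ' : InducedBy J' g) {p q : BWord × BWord} (hp : p ∈ J) (hq : q ∈ J')
    {x : CantorC} (hxp : x ∈ cyl p.1) (hxq : x ∈ cyl q.1) : EvenPair p ↔ EvenPair q := by
  wlog hle : p.1.length ≤ q.1.length generalizing p q J J'
  · exact (this hJ' hJ hq hp hxq hxp (by omega)).symm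
  obtain ⟨s, hs⟩ := exists_append_of_mem_cyl hxp hxq hle
  have key : ∀ y, wordApp (p.2 ++ s) y = wordApp q.2 y := by
    intro y
    apply g.injective
    rw [hJ' q hq, hs, wordApp_append, wordApp_append, hJ p hp]
  have h1 := length_le_of_wordApp_eq key
  have h2 := length_le_of_wordApp_eq fun y => (key y).symm
  have h3 := congrArg List.length hs
  simp only [List.length_append] at h1 h2 h3
  unfold EvenPair
  omega

theorem pF_eq_pSet {J : Finset (BWord × BWord)} {g : Equiv.Perm CantorC} (hJ : IsCodeFor J g) :
    pF g = pSet J := by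
  apply Subset.antisymm
  · intro x hx
    simp only [pF, mem_iUnion, mem_ofPred_eq, exists_prop] at hx
    obtain ⟨J', hJ', q, hq, heven, hxq⟩ := hx
    obtain ⟨p, ⟨hp, hxp⟩, -⟩ := hJ.1.1 x
    exact ⟨p, hp, (evenPair_of_evenPair hJ.2.2 hJ'.2.2 hp hq hxp hxq).2 heven, hxp⟩
  · intro x hx
    simp only [pF, mem_iUnion, mem_ofPred_eq, exists_prop]
    exact ⟨J, hJ, hx⟩

/-- `p` is a union of cylinders of words of length `n`. -/
def IsLevelSet (n : ℕ) (p : Set CantorC) : Prop :=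
  ∀ w : BWord, w.length = n → ∀ x ∈ cyl w, ∀ y ∈ cyl w, x ∈ p → y ∈ p

theorem exists_isLevelSet_pSet (J : Finset (BWord × BWord)) : ∃ n, IsLevelSet n (pSet J) := by
  refine ⟨J.sup fun p => p.1.length, ?_⟩
  rintro w hw x hx y hy ⟨p, hp, he, hxp⟩
  have hle : p.1.length ≤ w.length := by
    rw [hw]
    exact Finset.le_sup (f := fun p : BWord × BWord => p.1.length) hp
  obtain ⟨s, rfl⟩ := exists_append_of_mem_cyl hxp hx hle
  exact ⟨p, hp, he, cyl_append_subset _ _ hy⟩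

/-- `u` and `v` branch at some common prefix, with `u` to the left. -/
def IsLeftOf (u v : BWord) : Prop := ∃ c s t, u = c ++ false :: s ∧ v = c ++ true :: t

theorem IsLeftOf.append_left {u v : BWord} (h : IsLeftOf u v) (s : BWord) :
    IsLeftOf (u ++ s) v := by
  obtain ⟨c, a, b, rfl, rfl⟩ := h
  exact ⟨c, a ++ s, b, by simp, rfl⟩

theorem IsLeftOf.append_right {u v : BWord} (h : IsLeftOf u v) (s : BWord) :
    IsLeftOf u (v ++ s) := by
  obtain ⟨c, a, b, rfl, rfl⟩ := h
  exact ⟨c, a, b ++ s, rfl, by simp⟩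

theorem isLeftOf_children (u : BWord) : IsLeftOf (u ++ [false]) (u ++ [true]) :=
  ⟨u, [], [], rfl, rfl⟩

theorem IsLeftOf.lex {u v : BWord} (h : IsLeftOf u v) : List.Lex (· < ·) u v := by
  obtain ⟨c, a, b, rfl, rfl⟩ := h
  induction c with
  | nil => exact List.Lex.rel (by decide)
  | cons i c ih => exact List.Lex.cons ih

theorem IsLeftOf.not_lex {u v : BWord} (h : IsLeftOf u v) : ¬ List.Lex (· < ·) v u := by
  obtain ⟨c, a, b, rfl, rfl⟩ := h
  induction c with
  | nil =>
    intro h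
    cases h with
    | rel h => exact absurd h (by decide)
  | cons i c ih =>
    intro h
    cases h with
    | cons h => exact ih h
    | rel h => exact lt_irrefl _ h

theorem not_lex_self (u : BWord) : ¬ List.Lex (· < ·) u u := by
  induction u with
  | nil => intro h; cases h
  | cons i c ih =>
    intro h
    cases h with
    | cons h => exact ih h
    | rel h => exact lt_irrefl _ h

theorem IsLeftOf.notMem_cyl {u v : BWord} (h : IsLeftOf u v) {x : CantorC} (hu : x ∈ cyl u) :
    x ∉ cyl v := by
  obtain ⟨c, a, b, rfl, rfl⟩ := h
  intro hv
  have h1 := mem_cyl.1 hu c.length (by simp)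
  have h2 := mem_cyl.1 hv c.length (by simp)
  simp [h1] at h2

/-- The list of leaves, from left to right, of a finite binary tree. -/
inductive IsLeaves : List BWord → Prop
  | root : IsLeaves [[]]
  | split (l₁ : List BWord) (u : BWord) (l₂ : List BWord) : IsLeaves (l₁ ++ u :: l₂) →
      IsLeaves (l₁ ++ (u ++ [false]) :: (u ++ [true]) :: l₂)

theorem IsLeaves.pairwise {l : List BWord} (h : IsLeaves l) : l.Pairwise IsLeftOf := by
  induction h with
  | root => simp
  | split l₁ u l₂ _ ih =>
    simp only [List.pairwise_append, List.pairwise_cons, List.mem_cons] at ih ⊢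
    obtain ⟨h1, ⟨h2, h3⟩, h4⟩ := ih
    refine ⟨h1, ⟨?_, ?_, h3⟩, ?_⟩
    · rintro a (rfl | ha)
      · exact isLeftOf_children u
      · exact (h2 a ha).append_left _
    · exact fun a ha => (h2 a ha).append_left _
    · rintro a ha b (rfl | rfl | hb)
      · exact (h4 a ha u (Or.inl rfl)).append_right _
      · exact (h4 a ha u (Or.inl rfl)).append_right _
      · exact h4 a ha b (Or.inr hb)

theorem IsLeaves.exists_mem_cyl {l : List BWord} (h : IsLeaves l) (x : CantorC) :
    ∃ w ∈ l, x ∈ cyl w := by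
  induction h with
  | root => exact ⟨[], by simp, by simp⟩
  | split l₁ u l₂ _ ih =>
    obtain ⟨w, hw, hx⟩ := ih
    rw [List.mem_append, List.mem_cons] at hw
    rcases hw with hw | rfl | hw
    · exact ⟨w, by simp [hw], hx⟩
    · rw [cyl_eq_union] at hx
      rcases hx with hx | hx
      · exact ⟨_, by simp, hx⟩
      · exact ⟨_, by simp, hx⟩
    · exact ⟨w, by simp [hw], hx⟩

/-- The leaves of the complete binary tree of depth `m`. -/
theorem exists_isLeaves_length_eq (m : ℕ) : ∃ l, IsLeaves l ∧ ∀ w ∈ l, w.length = m := by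
  induction m with
  | zero => exact ⟨_, .root, by simp⟩
  | succ m ih =>
    obtain ⟨l, hl, hlen⟩ := ih
    have key : ∀ l pre : List BWord, IsLeaves (pre ++ l) →
        IsLeaves (pre ++ l.flatMap fun w => [w ++ [false], w ++ [true]]) := by
      intro l
      induction l with
      | nil => simp
      | cons u l ih =>
        intro pre h
        have := ih (pre ++ [u ++ [false], u ++ [true]]) (by simpa using IsLeaves.split _ _ _ h)
        simpa using this
    refine ⟨_, key l [] hl, ?_⟩
    intro w hw
    simp only [List.nil_append, List.mem_flatMap, List.mem_cons, List.not_mem_nil, or_false] at hw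
    obtain ⟨v, hv, rfl | rfl⟩ := hw <;> simp [hlen v hv]

theorem pairwise_zip {l l' : List BWord} (h : l.Pairwise IsLeftOf) (h' : l'.Pairwise IsLeftOf) :
    (l.zip l').Pairwise fun p q => IsLeftOf p.1 q.1 ∧ IsLeftOf p.2 q.2 := by
  induction l generalizing l' with
  | nil => simp
  | cons a l ih =>
    cases l' with
    | nil => simp
    | cons b l' =>
      rw [List.pairwise_cons] at h h'
      rw [List.zip_cons_cons, List.pairwise_cons]
      exact ⟨fun q hq => ⟨h.1 _ (List.of_mem_zip hq).1, h'.1 _ (List.of_mem_zip hq).2⟩,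
        ih h.2 h'.2⟩

theorem eq_or_isLeftOf_of_mem_zip {l l' : List BWord} (hl : IsLeaves l) (hl' : IsLeaves l')
    {p q : BWord × BWord} (hp : p ∈ l.zip l') (hq : q ∈ l.zip l') :
    p = q ∨ (IsLeftOf p.1 q.1 ∧ IsLeftOf p.2 q.2) ∨ (IsLeftOf q.1 p.1 ∧ IsLeftOf q.2 p.2) := by
  have h := pairwise_zip hl.pairwise hl'.pairwise
  obtain ⟨i, hi, rfl⟩ := List.mem_iff_getElem.1 hp
  obtain ⟨j, hj, rfl⟩ := List.mem_iff_getElem.1 hq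
  rw [List.pairwise_iff_getElem] at h
  rcases lt_trichotomy i j with hij | rfl | hij
  · exact Or.inr (Or.inl (h i j hi hj hij))
  · exact Or.inl rfl
  · exact Or.inr (Or.inr (h j i hj hi hij))

theorem isCode_zip {l l' : List BWord} (hl : IsLeaves l) (hl' : IsLeaves l')
    (hlen : l.length = l'.length) : IsCode (l.zip l').toFinset := by
  constructor
  · intro x
    obtain ⟨w, hw, hx⟩ := hl.exists_mem_cyl x
    obtain ⟨i, hi, rfl⟩ := List.mem_iff_getElem.1 hw
    have hm : (l[i], l'[i]) ∈ l.zip l' :=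
      List.mem_iff_getElem.2 ⟨i, by simp; omega, by simp⟩
    refine ⟨(l[i], l'[i]), ⟨by simpa using hm, hx⟩, ?_⟩
    rintro q ⟨hq, hxq⟩
    rcases eq_or_isLeftOf_of_mem_zip hl hl' (List.mem_toFinset.1 hq) hm with h | h | h
    · exact h
    · exact absurd hx (h.1.notMem_cyl hxq)
    · exact absurd hxq (h.1.notMem_cyl hx)
  · intro x
    obtain ⟨w, hw, hx⟩ := hl'.exists_mem_cyl x
    obtain ⟨i, hi, rfl⟩ := List.mem_iff_getElem.1 hw
    have hm : (l[i], l'[i]) ∈ l.zip l' :=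
      List.mem_iff_getElem.2 ⟨i, by simp; omega, by simp⟩
    refine ⟨(l[i], l'[i]), ⟨by simpa using hm, hx⟩, ?_⟩
    rintro q ⟨hq, hxq⟩
    rcases eq_or_isLeftOf_of_mem_zip hl hl' (List.mem_toFinset.1 hq) hm with h | h | h
    · exact h
    · exact absurd hx (h.2.notMem_cyl hxq)
    · exact absurd hxq (h.2.notMem_cyl hx)

theorem ordPres_zip {l l' : List BWord} (hl : IsLeaves l) (hl' : IsLeaves l') :
    OrdPres (l.zip l').toFinset := by
  intro p hp q hq
  rcases eq_or_isLeftOf_of_mem_zip hl hl' (List.mem_toFinset.1 hp) (List.mem_toFinset.1 hq)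
    with rfl | h | h
  · exact iff_of_false (not_lex_self _) (not_lex_self _)
  · exact iff_of_true h.1.lex h.2.lex
  · exact iff_of_false h.1.not_lex h.2.not_lex

theorem IsCode.exists_inducedBy {J : Finset (BWord × BWord)} (hJ : IsCode J) :
    ∃ g : Equiv.Perm CantorC, InducedBy J g := by
  choose a ha ha' using hJ.1
  choose b hb hb' using hJ.2
  have h1 : ∀ x, ∃ z, wordApp (a x).1 z = x := fun x => (ha x).2
  have h2 : ∀ x, ∃ z, wordApp (b x).2 z = x := fun x => (hb x).2
  choose u hu using h1
  choose v hv using h2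
  have ea : ∀ p ∈ J, ∀ z, a (wordApp p.1 z) = p := fun p hp z =>
    (ha' _ p ⟨hp, wordApp_mem_cyl _ _⟩).symm
  have eb : ∀ p ∈ J, ∀ z, b (wordApp p.2 z) = p := fun p hp z =>
    (hb' _ p ⟨hp, wordApp_mem_cyl _ _⟩).symm
  have eu : ∀ p ∈ J, ∀ z, u (wordApp p.1 z) = z := fun p hp z =>
    wordApp_injective p.1 (by simpa only [ea p hp z] using hu (wordApp p.1 z))
  have ev : ∀ p ∈ J, ∀ z, v (wordApp p.2 z) = z := fun p hp z =>
    wordApp_injective p.2 (by simpa only [eb p hp z] using hv (wordApp p.2 z))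
  refine ⟨⟨fun x => wordApp (b x).1 (v x), fun x => wordApp (a x).2 (u x), ?_, ?_⟩, ?_⟩
  · intro x
    simp only [ea _ (hb x).1, eu _ (hb x).1, hv]
  · intro x
    simp only [eb _ (ha x).1, ev _ (ha x).1, hu]
  · intro p hp x
    simp only [Equiv.coe_fn_mk, eb p hp, ev p hp]

theorem pSet_zip_mem_Omega2 {l l' : List BWord} (hl : IsLeaves l) (hl' : IsLeaves l')
    (hlen : l.length = l'.length) : pSet (l.zip l').toFinset ∈ Omega2 := by
  obtain ⟨g, hg⟩ := (isCode_zip hl hl' hlen).exists_inducedBy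
  have hJ : IsCodeFor (l.zip l').toFinset g := ⟨isCode_zip hl hl' hlen, ordPres_zip hl hl', hg⟩
  exact ⟨g, ⟨_, hJ⟩, pF_eq_pSet hJ⟩

theorem exists_isLeaves_left (c : BWord → Prop) (l : List BWord) :
    ∃ vs u rest, IsLeaves (vs ++ u :: rest) ∧
      List.Forall₂ (fun w v => EvenPair (w, v) ↔ c w) l vs := by
  induction l using List.reverseRecOn with
  | nil => exact ⟨[], [], [], .root, .nil⟩
  | append_singleton l w ih =>
    obtain ⟨vs, u, rest, hL, hF⟩ := ih
    have h1 := IsLeaves.split _ _ _ hL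
    by_cases h : EvenPair (w, u ++ [false]) ↔ c w
    · exact ⟨vs ++ [u ++ [false]], _, rest, by simpa using h1,
        List.rel_append hF (.cons h .nil)⟩
    · have h2 := IsLeaves.split _ _ _ h1
      refine ⟨vs ++ [u ++ [false] ++ [false]], _, (u ++ [true]) :: rest, by simpa using h2,
        List.rel_append hF (.cons ?_ .nil)⟩
      simp only [EvenPair, List.length_append, List.length_cons, List.length_nil] at h ⊢
      by_cases hc : c w <;> simp only [hc, iff_true, iff_false] at h ⊢ <;> omega

theorem exists_isLeaves_both (c : BWord → Prop) (l₁ l₂ : List BWord) :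
    ∃ vs rest u us, IsLeaves (vs ++ rest ++ u :: us) ∧
      List.Forall₂ (fun w v => EvenPair (w, v) ↔ c w) l₁ vs ∧
      List.Forall₂ (fun w v => EvenPair (w, v) ↔ c w) l₂ us := by
  induction l₂ with
  | nil =>
    obtain ⟨vs, u, rest, hL, hF⟩ := exists_isLeaves_left c l₁
    rcases List.eq_nil_or_concat rest with rfl | ⟨rest, u', rfl⟩
    · exact ⟨vs, [], u, [], by simpa using hL, hF, .nil⟩
    · exact ⟨vs, u :: rest, u', [], by simpa using hL, hF, .nil⟩
  | cons w l ih =>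
    obtain ⟨vs, rest, u, us, hL, hF, hG⟩ := ih
    have h1 := IsLeaves.split _ _ _ hL
    by_cases h : EvenPair (w, u ++ [true]) ↔ c w
    · exact ⟨vs, rest, _, (u ++ [true]) :: us, h1, hF, .cons h hG⟩
    · have h2 := IsLeaves.split (vs ++ rest ++ [u ++ [false]]) (u ++ [true]) us (by simpa using h1)
      refine ⟨vs, rest ++ [u ++ [false]], _, _ :: us, by simpa using h2, hF, .cons ?_ hG⟩
      simp only [EvenPair, List.length_append, List.length_cons, List.length_nil] at h ⊢
      by_cases hc : c w <;> simp only [hc, iff_true, iff_false] at h ⊢ <;> omega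

theorem exists_isLeaves_subdivide {l₁ l₂ : List BWord} {u : BWord} (h : IsLeaves (l₁ ++ u :: l₂))
    (k : ℕ) : ∃ ms : List BWord, ms.length = k + 1 ∧ (∀ m ∈ ms, u <+: m) ∧
      IsLeaves (l₁ ++ ms ++ l₂) := by
  induction k with
  | zero => exact ⟨[u], rfl, by simp, by simpa using h⟩
  | succ k ih =>
    obtain ⟨ms, hlen, hpre, hL⟩ := ih
    cases ms with
    | nil => simp at hlen
    | cons m ms =>
      refine ⟨(m ++ [false]) :: (m ++ [true]) :: ms, by simpa using hlen, ?_, ?_⟩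
      · have hm : u <+: m := hpre m (by simp)
        simp only [List.mem_cons]
        rintro a (rfl | rfl | ha)
        · exact hm.trans (List.prefix_append _ _)
        · exact hm.trans (List.prefix_append _ _)
        · exact hpre a (by simp [ha])
      · have := IsLeaves.split l₁ m (ms ++ l₂) (by simpa using hL)
        simpa using this

/-- Every level set can be turned into an element of `Omega2` by changing it inside a single
prescribed cylinder. -/
theorem exists_mem_Omega2_agree {m : ℕ} {p : Set CantorC} (hp : IsLevelSet m p) {u : BWord}
    (hu : u.length = m) : ∃ q ∈ Omega2, ∀ x ∉ cyl u, (x ∈ q ↔ x ∈ p) := by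
  obtain ⟨l, hl, hlen⟩ := exists_isLeaves_length_eq m
  have hul : u ∈ l := by
    obtain ⟨w, hw, hx⟩ := hl.exists_mem_cyl (wordApp u fun _ => false)
    rwa [eq_of_mem_cyl (wordApp_mem_cyl u _) hx (by rw [hu, hlen w hw])]
  obtain ⟨l₁, l₂, rfl⟩ := List.append_of_mem hul
  set c : BWord → Prop := fun w => wordApp w (fun _ => false) ∈ p
  obtain ⟨vs, rest, v, us, hL, hF, hG⟩ := exists_isLeaves_both c l₁ l₂
  obtain ⟨ms, hms, hpre, hM⟩ := exists_isLeaves_subdivide hl rest.length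
  have hL' : IsLeaves (vs ++ (rest ++ [v]) ++ us) := by simpa using hL
  have e1 : l₁.length = vs.length := hF.length_eq
  have e2 : l₂.length = us.length := hG.length_eq
  have hlen' : (l₁ ++ ms ++ l₂).length = (vs ++ (rest ++ [v]) ++ us).length := by
    simp only [List.length_append, List.length_singleton]
    omega
  refine ⟨_, pSet_zip_mem_Omega2 hM hL' hlen', ?_⟩
  intro x hx
  have hz : (l₁ ++ ms ++ l₂).zip (vs ++ (rest ++ [v]) ++ us) =
      l₁.zip vs ++ ms.zip (rest ++ [v]) ++ l₂.zip us := by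
    rw [List.zip_append, List.zip_append e1]
    simp only [List.length_append, List.length_singleton]
    omega
  have hcode := isCode_zip hM hL' hlen'
  obtain ⟨q, ⟨hq, hxq⟩, huniq⟩ := hcode.1 x
  have hsign : ∀ l' vs' : List BWord, (∀ w ∈ l', w.length = m) →
      List.Forall₂ (fun w v => EvenPair (w, v) ↔ c w) l' vs' → q ∈ l'.zip vs' →
      (EvenPair q ↔ x ∈ p) := by
    intro l' vs' hm hF hq
    rw [List.forall₂_iff_zip.1 hF |>.2 hq]
    have hw := hm _ (List.of_mem_zip hq).1
    exact ⟨hp _ hw _ (wordApp_mem_cyl _ _) _ hxq, hp _ hw _ hxq _ (wordApp_mem_cyl _ _)⟩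
  have hqe : EvenPair q ↔ x ∈ p := by
    rw [List.mem_toFinset, hz, List.mem_append, List.mem_append] at hq
    rcases hq with (hq | hq) | hq
    · exact hsign _ _ (fun w hw => hlen w (by simp [hw])) hF hq
    · obtain ⟨s, hs⟩ := hpre _ (List.of_mem_zip hq).1
      rw [← hs] at hxq
      exact absurd (cyl_append_subset _ _ hxq) hx
    · exact hsign _ _ (fun w hw => hlen w (by simp [hw])) hG hq
  rw [← hqe]
  constructor
  · rintro ⟨q', hq', he, hxq'⟩
    rwa [← huniq q' ⟨hq', hxq'⟩]
  · exact fun he => ⟨q, hq, he, hxq⟩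

/-- A pair of pruned binary trees whose union is the full tree. -/
structure IsTreePair (d : (BWord → Bool) × (BWord → Bool)) : Prop where
  fst : ∀ w, d.1 w = (d.1 (w ++ [false]) || d.1 (w ++ [true]))
  snd : ∀ w, d.2 w = (d.2 (w ++ [false]) || d.2 (w ++ [true]))
  union : ∀ w, (d.1 w || d.2 w) = true

/-- The two trees share a word of every length. -/
def IsTouching (d : (BWord → Bool) × (BWord → Bool)) : Prop :=
  ∀ n, ∃ w : BWord, w.length = n ∧ d.1 w = true ∧ d.2 w = true

theorem Tb_eq_true {p : Set CantorC} {w : BWord} : Tb p w = true ↔ (cyl w ∩ p).Nonempty := by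
  simp [Tb]

theorem Tb_eq_or (p : Set CantorC) (w : BWord) :
    Tb p w = (Tb p (w ++ [false]) || Tb p (w ++ [true])) := by
  rw [Bool.eq_iff_iff, Bool.or_eq_true, Tb_eq_true, Tb_eq_true, Tb_eq_true, cyl_eq_union w,
    union_inter_distrib_right, union_nonempty]

theorem isTreePair_embedT (p : Set CantorC) : IsTreePair (embedT p) where
  fst := Tb_eq_or p
  snd := Tb_eq_or pᶜ
  union w := by
    rw [Bool.or_eq_true]
    by_cases h : wordApp w (fun _ => false) ∈ p
    · exact Or.inl (Tb_eq_true.2 ⟨_, wordApp_mem_cyl _ _, h⟩)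
    · exact Or.inr (Tb_eq_true.2 ⟨_, wordApp_mem_cyl _ _, h⟩)

theorem not_isTouching_embedT {p : Set CantorC} {n : ℕ} (hp : IsLevelSet n p) :
    ¬ IsTouching (embedT p) := by
  intro h
  obtain ⟨w, hw, h1, h2⟩ := h n
  obtain ⟨x, hx, hxp⟩ := Tb_eq_true.1 h1
  obtain ⟨y, hy, hyp⟩ := Tb_eq_true.1 h2
  exact hyp (hp w hw x hx y hy hxp)

theorem isClosed_isTreePair : IsClosed {d | IsTreePair d} := by
  have : {d | IsTreePair d} =
      (⋂ w, {d : (BWord → Bool) × (BWord → Bool) |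
        d.1 w = (d.1 (w ++ [false]) || d.1 (w ++ [true]))}) ∩
      (⋂ w, {d : (BWord → Bool) × (BWord → Bool) |
        d.2 w = (d.2 (w ++ [false]) || d.2 (w ++ [true]))}) ∩
      (⋂ w, {d : (BWord → Bool) × (BWord → Bool) | (d.1 w || d.2 w) = true}) := by
    ext d
    simp only [mem_inter_iff, mem_iInter, mem_ofPred_eq]
    exact ⟨fun h => ⟨⟨h.fst, h.snd⟩, h.union⟩, fun h => ⟨h.1.1, h.1.2, h.2⟩⟩
  have h1 : ∀ w : BWord, Continuous fun d : (BWord → Bool) × (BWord → Bool) => d.1 w :=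
    fun w => by fun_prop
  have h2 : ∀ w : BWord, Continuous fun d : (BWord → Bool) × (BWord → Bool) => d.2 w :=
    fun w => by fun_prop
  have hor : Continuous fun b : Bool × Bool => (b.1 || b.2) := continuous_of_discreteTopology
  rw [this]
  refine ((isClosed_iInter fun w => ?_).inter (isClosed_iInter fun w => ?_)).inter
    (isClosed_iInter fun w => ?_)
  · exact isClosed_eq (h1 w) (hor.comp ((h1 _).prodMk (h1 _)))
  · exact isClosed_eq (h2 w) (hor.comp ((h2 _).prodMk (h2 _)))
  · exact isClosed_eq (hor.comp ((h1 _).prodMk (h2 _))) continuous_const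

theorem isClosed_isTouching : IsClosed {d | IsTouching d} := by
  have : {d | IsTouching d} = ⋂ n, ⋃ w ∈ {w : BWord | w.length = n},
      {d : (BWord → Bool) × (BWord → Bool) | d.1 w = true ∧ d.2 w = true} := by
    ext d
    simp only [mem_iInter, mem_iUnion, mem_ofPred_eq, IsTouching, exists_prop]
  rw [this]
  refine isClosed_iInter fun n => (List.finite_length_eq Bool n).isClosed_biUnion fun w _ => ?_
  exact (isClosed_eq (by fun_prop) continuous_const).inter
    (isClosed_eq (by fun_prop) continuous_const)

/-- A pruned tree is determined up to level `n` by its words of length `n`. -/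
theorem eq_of_length_le {a b : BWord → Bool}
    (ha : ∀ w, a w = (a (w ++ [false]) || a (w ++ [true])))
    (hb : ∀ w, b w = (b (w ++ [false]) || b (w ++ [true]))) {n : ℕ}
    (h : ∀ w : BWord, w.length = n → a w = b w) (w : BWord) (hw : w.length ≤ n) : a w = b w := by
  induction hk : n - w.length generalizing w with
  | zero => exact h w (by omega)
  | succ k ih =>
    rw [ha, hb, ih, ih] <;> simp only [List.length_append, List.length_singleton] <;> omega

theorem apply_append_eq_false {a : BWord → Bool}
    (ha : ∀ w, a w = (a (w ++ [false]) || a (w ++ [true]))) {u : BWord} (hu : a u = false)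
    (s : BWord) : a (u ++ s) = false := by
  induction s using List.reverseRecOn with
  | nil => simpa using hu
  | append_singleton s b ih =>
    rw [ha, Bool.or_eq_false_iff] at ih
    rw [← List.append_assoc]
    cases b
    · exact ih.1
    · exact ih.2

theorem IsTreePair.eq_of_level {d e : (BWord → Bool) × (BWord → Bool)} (hd : IsTreePair d)
    (he : IsTreePair e) {n : ℕ} (h : ∀ w : BWord, w.length = n → d.1 w = e.1 w ∧ d.2 w = e.2 w)
    (hn : ¬ ∃ w : BWord, w.length = n ∧ d.1 w = true ∧ d.2 w = true) : d = e := by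
  have key : ∀ w, d.1 w = e.1 w ∧ d.2 w = e.2 w := by
    intro w
    rcases le_total w.length n with hw | hw
    · exact ⟨eq_of_length_le hd.fst he.fst (fun w hw => (h w hw).1) w hw,
        eq_of_length_le hd.snd he.snd (fun w hw => (h w hw).2) w hw⟩
    · have hlen : (w.take n).length = n := by simpa using hw
      obtain ⟨h1, h2⟩ := h _ hlen
      have hdu := hd.union w
      have heu := he.union w
      by_cases hc : d.1 (w.take n) = true
      · have hc2 : d.2 (w.take n) = false := by
          by_contra hne
          exact hn ⟨_, hlen, hc, by simpa using hne⟩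
        have a1 := apply_append_eq_false hd.snd hc2 (w.drop n)
        have a2 := apply_append_eq_false he.snd (h2 ▸ hc2) (w.drop n)
        rw [List.take_append_drop] at a1 a2
        simp_all
      · rw [Bool.not_eq_true] at hc
        have a1 := apply_append_eq_false hd.fst hc (w.drop n)
        have a2 := apply_append_eq_false he.fst (h1 ▸ hc) (w.drop n)
        rw [List.take_append_drop] at a1 a2
        simp_all
  exact Prod.ext (funext fun w => (key w).1) (funext fun w => (key w).2)

theorem tendsto_of_agree {s : ℕ → (BWord → Bool) × (BWord → Bool)}
    {d : (BWord → Bool) × (BWord → Bool)}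
    (h : ∀ n, ∀ w : BWord, w.length ≤ n → (s n).1 w = d.1 w ∧ (s n).2 w = d.2 w) :
    Tendsto s atTop (𝓝 d) := by
  rw [Prod.tendsto_iff, tendsto_pi_nhds, tendsto_pi_nhds]
  refine ⟨fun w => tendsto_nhds_of_eventually_eq ?_, fun w => tendsto_nhds_of_eventually_eq ?_⟩
  · filter_upwards [eventually_ge_atTop w.length] with n hn using (h n w hn).1
  · filter_upwards [eventually_ge_atTop w.length] with n hn using (h n w hn).2

theorem exists_mem_Omega2_near {d : (BWord → Bool) × (BWord → Bool)} (hd : IsTreePair d)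
    (ht : IsTouching d) (n : ℕ) : ∃ q ∈ Omega2, ∀ w : BWord, w.length ≤ n →
      (embedT q).1 w = d.1 w ∧ (embedT q).2 w = d.2 w := by
  obtain ⟨t, htl, ht1, ht2⟩ := ht n
  let pre : CantorC → BWord := fun x => List.ofFn fun i : Fin n => x i
  have hpre : ∀ w : BWord, w.length = n → ∀ x ∈ cyl w, pre x = w := by
    intro w hw x hx
    rw [mem_cyl] at hx
    apply List.ext_getElem
    · simp [pre, hw]
    · intro i h1 h2
      simp [pre, hx i h2]
  let p : Set CantorC := {x | d.1 (pre x) = true ∧ (d.2 (pre x) = false ∨ x (n + 1) = true)}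
  have hp : IsLevelSet (n + 2) p := by
    intro w hw x hx y hy hxp
    have hv : (w.take n).length = n := by simp [hw]
    have hcyl : cyl w ⊆ cyl (w.take n) := by
      conv_lhs => rw [← List.take_append_drop n w]
      exact cyl_append_subset _ _
    have h1 := hpre _ hv x (hcyl hx)
    have h2 := hpre _ hv y (hcyl hy)
    have h3 := mem_cyl.1 hx (n + 1) (by omega)
    have h4 := mem_cyl.1 hy (n + 1) (by omega)
    simp only [p, mem_ofPred_eq] at hxp ⊢
    rwa [h2, h4, ← h3, ← h1]
  obtain ⟨q, hq, hagree⟩ := exists_mem_Omega2_agree hp (u := t ++ [false, false]) (by simp [htl])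
  have hlevel : ∀ w : BWord, w.length = n →
      (embedT q).1 w = d.1 w ∧ (embedT q).2 w = d.2 w := by
    intro w hw
    have hu := hd.union w
    have hin : ∀ s : BWord, wordApp (w ++ s) (fun _ => false) ∈ cyl w :=
      fun s => cyl_append_subset _ _ (wordApp_mem_cyl _ _)
    have hmem : ∀ x ∈ cyl w, (x ∈ p ↔ d.1 w = true ∧ (d.2 w = false ∨ x (n + 1) = true)) := by
      intro x hx
      simp only [p, mem_ofPred_eq, hpre w hw x hx]
    have hnot : ∀ x ∈ cyl w, ¬ (d.1 w = true ∧ d.2 w = true) → x ∉ cyl (t ++ [false, false]) := by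
      intro x hx hne hxt
      have := eq_of_mem_cyl hx (cyl_append_subset _ _ hxt) (by rw [hw, htl])
      subst this
      exact hne ⟨ht1, ht2⟩
    have hnot' : ∀ s : BWord, (s = [false, true] ∨ s = [true, false]) →
        wordApp (w ++ s) (fun _ => false) ∉ cyl (t ++ [false, false]) := by
      intro s hs hxt
      have h0 := mem_cyl.1 hxt n (by simp [htl])
      have h1 := mem_cyl.1 hxt (n + 1) (by simp [htl])
      rcases hs with rfl | rfl <;> simp [wordApp, hw, htl] at h0 h1
    have hred : ∀ a b a' b' : Bool, ((a = true ↔ a' = true) ∧ (b = true ↔ b' = true)) →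
        a = a' ∧ b = b' := by decide
    refine hred _ _ _ _ ?_
    change (Tb q w = true ↔ _) ∧ (Tb qᶜ w = true ↔ _)
    rw [Tb_eq_true, Tb_eq_true]
    have c1 : wordApp (w ++ [false, true]) (fun _ => false) (n + 1) = true := by
      simp [wordApp, hw]
    have c2 : wordApp (w ++ [true, false]) (fun _ => false) (n + 1) = false := by
      simp [wordApp, hw]
    have m1 : wordApp (w ++ [false, true]) (fun _ => false) ∈ q ↔ d.1 w = true := by
      rw [hagree _ (hnot' _ (Or.inl rfl)), hmem _ (hin _), c1]
      simp
    have m2 : wordApp (w ++ [true, false]) (fun _ => false) ∈ qᶜ ↔ d.2 w = true := by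
      rw [mem_compl_iff, hagree _ (hnot' _ (Or.inr rfl)), hmem _ (hin _), c2]
      revert hu
      cases d.1 w <;> cases d.2 w <;> simp
    refine ⟨⟨?_, fun h => ⟨_, hin _, m1.2 h⟩⟩, ⟨?_, fun h => ⟨_, hin _, m2.2 h⟩⟩⟩
    · rintro ⟨x, hx, hxq⟩
      by_contra hne
      rw [hagree x (hnot x hx fun h => hne h.1), hmem x hx] at hxq
      exact hne hxq.1
    · rintro ⟨x, hx, hxq⟩
      by_contra hne
      rw [mem_compl_iff, hagree x (hnot x hx fun h => hne h.2), hmem x hx] at hxq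
      revert hu hne hxq
      cases d.1 w <;> cases d.2 w <;> simp
  have he := isTreePair_embedT q
  exact ⟨q, hq, fun w hw => ⟨eq_of_length_le he.fst hd.fst (fun w hw => (hlevel w hw).1) w hw,
    eq_of_length_le he.snd hd.snd (fun w hw => (hlevel w hw).2) w hw⟩⟩

theorem boundary_eq : OmegaBar \ (embedT '' Omega2) = {d | IsTreePair d} ∩ {d | IsTouching d} := by
  ext d
  constructor
  · rintro ⟨hd, hnot⟩
    have htree : IsTreePair d := by
      refine closure_minimal ?_ isClosed_isTreePair hd
      rintro _ ⟨p, -, rfl⟩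
      exact isTreePair_embedT p
    refine ⟨htree, ?_⟩
    by_contra htouch
    simp only [mem_ofPred_eq, IsTouching, not_forall] at htouch
    obtain ⟨n, hn⟩ := htouch
    have hopen : IsOpen (⋂ w ∈ {w : BWord | w.length = n},
        {e : (BWord → Bool) × (BWord → Bool) | e.1 w = d.1 w ∧ e.2 w = d.2 w}) := by
      refine (List.finite_length_eq Bool n).isOpen_biInter fun w _ => ?_
      have h1 : Continuous fun e : (BWord → Bool) × (BWord → Bool) => (e.1 w, e.2 w) := by fun_prop
      convert (isOpen_discrete {(d.1 w, d.2 w)}).preimage h1 using 1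
      ext e
      simp
    obtain ⟨e, he, q, hq, rfl⟩ := mem_closure_iff.1 hd _ hopen (by simp)
    simp only [mem_iInter, mem_ofPred_eq] at he
    refine hnot ⟨q, hq, (htree.eq_of_level (isTreePair_embedT q) (fun w hw => ?_) hn).symm⟩
    exact ⟨(he w hw).1.symm, (he w hw).2.symm⟩
  · rintro ⟨htree, htouch⟩
    constructor
    · choose q hq hnear using exists_mem_Omega2_near htree htouch
      exact mem_closure_of_tendsto (tendsto_of_agree hnear)
        (Eventually.of_forall fun n => mem_image_of_mem _ (hq n))
    · rintro ⟨_, ⟨g, ⟨J, hJ⟩, rfl⟩, rfl⟩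
      rw [pF_eq_pSet hJ] at htouch
      obtain ⟨n, hn⟩ := exists_isLevelSet_pSet J
      exact not_isTouching_embedT hn htouch

theorem take_or (a : BWord → Bool) (ha : ∀ w, a w = (a (w ++ [false]) || a (w ++ [true])))
    (n : ℕ) (w : BWord) :
    a (w.take n) = (a ((w ++ [false]).take n) || a ((w ++ [true]).take n)) := by
  rcases lt_or_ge w.length n with h | h
  · have h1 : ∀ b, (w ++ [b]).take n = w ++ [b] := fun b =>
      List.take_of_length_le (by simpa using h)
    rw [h1, h1, List.take_of_length_le h.le]
    exact ha w
  · have h1 : ∀ b, (w ++ [b]).take n = w.take n := fun b => List.take_append_of_le_length h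
    rw [h1, h1, Bool.or_self]

/-- No point of the boundary is isolated. -/
theorem exists_ne_agree {d : (BWord → Bool) × (BWord → Bool)} (hd : IsTreePair d)
    (ht : IsTouching d) (n : ℕ) : ∃ e, IsTreePair e ∧ IsTouching e ∧ e ≠ d ∧
      ∀ w : BWord, w.length ≤ n → e.1 w = d.1 w ∧ e.2 w = d.2 w := by
  let a : BWord → Bool := fun w => d.1 (w.take n)
  let b₁ : BWord → Bool := fun w => d.2 (w.take n)
  let b₂ : BWord → Bool := fun w =>
    d.2 (w.take n) && (!d.1 (w.take n) || (w.drop n).all fun c => !c)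
  have hagree : ∀ w : BWord, w.length ≤ n → a w = d.1 w ∧ b₁ w = d.2 w ∧ b₂ w = d.2 w := by
    intro w hw
    simp [a, b₁, b₂, List.take_of_length_le hw, List.drop_of_length_le hw]
  have hlong : ∀ t : BWord, t.length = n → ∀ s, a (t ++ s) = d.1 t ∧ b₁ (t ++ s) = d.2 t ∧
      b₂ (t ++ s) = (d.2 t && (!d.1 t || s.all fun c => !c)) := by
    rintro t rfl s
    simp [a, b₁, b₂]
  have htouch : ∀ m, ∃ w : BWord, w.length = m ∧ a w = true ∧ b₁ w = true ∧ b₂ w = true := by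
    intro m
    rcases le_total m n with h | h
    · obtain ⟨w, hw, h1, h2⟩ := ht m
      obtain ⟨e1, e2, e3⟩ := hagree w (by omega)
      exact ⟨w, hw, e1.trans h1, e2.trans h2, e3.trans h2⟩
    · obtain ⟨w, hw, h1, h2⟩ := ht n
      obtain ⟨e1, e2, e3⟩ := hlong w hw (List.replicate (m - n) false)
      refine ⟨w ++ List.replicate (m - n) false, by simp; omega, e1.trans h1, e2.trans h2, ?_⟩
      rw [e3, h2]
      simp
  have hb₂ : ∀ w, b₂ w = (b₂ (w ++ [false]) || b₂ (w ++ [true])) := by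
    intro w
    rcases lt_or_ge w.length n with h | h
    · rw [(hagree w h.le).2.2, (hagree (w ++ [false]) (by simpa using h)).2.2,
        (hagree (w ++ [true]) (by simpa using h)).2.2, hd.snd]
    · have hw : w = w.take n ++ w.drop n := (List.take_append_drop n w).symm
      have hl : (w.take n).length = n := by simpa using h
      rw [hw, List.append_assoc, List.append_assoc, (hlong _ hl _).2.2, (hlong _ hl _).2.2,
        (hlong _ hl _).2.2]
      cases d.1 (w.take n) <;> cases d.2 (w.take n) <;> simp
  have hE₁ : IsTreePair (a, b₁) :=
    ⟨take_or _ hd.fst n, take_or _ hd.snd n, fun w => hd.union _⟩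
  have hE₂ : IsTreePair (a, b₂) := by
    refine ⟨take_or _ hd.fst n, hb₂, fun w => ?_⟩
    have := hd.union (w.take n)
    simp only [a, b₂]
    revert this
    cases d.1 (w.take n) <;> cases d.2 (w.take n) <;> simp
  have hT₁ : IsTouching (a, b₁) := fun m =>
    let ⟨w, hw, h1, h2, _⟩ := htouch m
    ⟨w, hw, h1, h2⟩
  have hT₂ : IsTouching (a, b₂) := fun m =>
    let ⟨w, hw, h1, _, h2⟩ := htouch m
    ⟨w, hw, h1, h2⟩
  have hne : b₁ ≠ b₂ := by
    obtain ⟨w, hw, h1, h2⟩ := ht n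
    obtain ⟨-, e2, e3⟩ := hlong w hw [true]
    intro h
    rw [h, e3, h1, h2] at e2
    simp at e2
  by_cases h : (a, b₁) = d
  · refine ⟨(a, b₂), hE₂, hT₂, fun h' => hne ?_, fun w hw => ⟨(hagree w hw).1, (hagree w hw).2.2⟩⟩
    rw [← h] at h'
    exact (congrArg Prod.snd h').symm
  · exact ⟨(a, b₁), hE₁, hT₁, h, fun w hw => ⟨(hagree w hw).1, (hagree w hw).2.1⟩⟩

/-- A nonempty compact space without isolated points in which countably many continuous
Boolean functions separate points is homeomorphic to the Cantor space. -/
theorem nonempty_homeomorph_cantor {X : Type*} [TopologicalSpace X] [CompactSpace X] [Nonempty X]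
    (f : ℕ → X → Bool) (hf : ∀ n, Continuous (f n)) (hsep : ∀ x y, (∀ n, f n x = f n y) → x = y)
    (hperf : ∀ x : X, ¬ IsOpen {x}) : Nonempty (X ≃ₜ (ℕ → Bool)) := by
  have hsplit : ∀ (A : Set X) (n : ℕ), ∃ k, IsOpen A → A.Nonempty →
      (∀ b, ∃ x ∈ A, f k x = b) ∧ ∀ x ∈ A, ∀ y ∈ A, f k x = f k y → f n x = f n y := by
    intro A n
    have both : ∀ k, ∀ x ∈ A, ∀ y ∈ A, f k x ≠ f k y → ∀ b, ∃ x ∈ A, f k x = b := by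
      intro k x hx y hy hne b
      by_cases hb : f k x = b
      · exact ⟨x, hx, hb⟩
      · refine ⟨y, hy, ?_⟩
        revert hne hb
        cases f k x <;> cases f k y <;> cases b <;> simp
    by_cases hc : ∀ x ∈ A, ∀ y ∈ A, f n x = f n y
    · by_cases hA : IsOpen A ∧ A.Nonempty
      · obtain ⟨hA, x, hx⟩ := hA
        have : ∃ y ∈ A, y ≠ x := by
          by_contra! h
          exact hperf x (by rwa [← eq_singleton_iff_unique_mem.2 ⟨hx, h⟩])
        obtain ⟨y, hy, hne⟩ := this
        have : ∃ k, f k y ≠ f k x := by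
          by_contra! h
          exact hne (hsep _ _ h)
        obtain ⟨k, hk⟩ := this
        exact ⟨k, fun _ _ => ⟨both k y hy x hx hk, fun x hx y hy _ => hc x hx y hy⟩⟩
      · exact ⟨0, fun h1 h2 => absurd ⟨h1, h2⟩ hA⟩
    · push Not at hc
      obtain ⟨x, hx, y, hy, hne⟩ := hc
      exact ⟨n, fun _ _ => ⟨both n x hx y hy hne, fun _ _ _ _ h => h⟩⟩
  choose k hk using hsplit
  let cell : (ℕ → Bool) → ℕ → Set X := fun c n =>
    Nat.rec univ (fun n A => A ∩ f (k A n) ⁻¹' {c n}) n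
  have cell_succ : ∀ c n, cell c (n + 1) = cell c n ∩ f (k (cell c n) n) ⁻¹' {c n} :=
    fun c n => rfl
  have cell_clopen : ∀ c n, IsClopen (cell c n) := by
    intro c n
    induction n with
    | zero => exact isClopen_univ
    | succ n ih => exact ih.inter ((isClopen_discrete _).preimage (hf _))
  have cell_nonempty : ∀ c n, (cell c n).Nonempty := by
    intro c n
    induction n with
    | zero => exact univ_nonempty
    | succ n ih =>
      obtain ⟨x, hx, hxc⟩ := (hk _ n (cell_clopen c n).isOpen ih).1 (c n)
      exact ⟨x, hx, hxc⟩
  have cell_const : ∀ c n, ∀ x ∈ cell c (n + 1), ∀ y ∈ cell c (n + 1), f n x = f n y := by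
    intro c n x hx y hy
    exact (hk _ n (cell_clopen c n).isOpen (cell_nonempty c n)).2 x hx.1 y hy.1
      (hx.2.trans hy.2.symm)
  have cell_congr : ∀ c c' n, (∀ i < n, c i = c' i) → cell c n = cell c' n := by
    intro c c' n h
    induction n with
    | zero => rfl
    | succ n ih =>
      rw [cell_succ, cell_succ, ih fun i hi => h i (by omega), h n (by omega)]
  have cell_inter : ∀ c, ∃ x, ∀ n, x ∈ cell c n := by
    intro c
    obtain ⟨x, hx⟩ := IsCompact.nonempty_iInter_of_sequence_nonempty_isCompact_isClosed (cell c)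
      (fun n => inter_subset_left) (cell_nonempty c) isCompact_univ
      (fun n => (cell_clopen c n).isClosed)
    exact ⟨x, mem_iInter.1 hx⟩
  choose φ hφ using cell_inter
  have hinj : Function.Injective φ := by
    intro c c' h
    by_contra hne
    have hex : ∃ n, c n ≠ c' n := by
      by_contra! h
      exact hne (funext h)
    classical
    have hlt : ∀ i < Nat.find hex, c i = c' i := fun i hi => not_not.1 (Nat.find_min hex hi)
    have h1 := (hφ c (Nat.find hex + 1)).2
    have h2 := (hφ c' (Nat.find hex + 1)).2
    have h3 := cell_congr _ _ _ hlt
    simp only [cell] at h3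
    rw [h, h3] at h1
    exact Nat.find_spec hex (h1.symm.trans h2)
  have hsurj : Function.Surjective φ := by
    intro x
    let D : ℕ → Set X := fun n => Nat.rec univ (fun n A => A ∩ f (k A n) ⁻¹' {f (k A n) x}) n
    let c : ℕ → Bool := fun n => f (k (D n) n) x
    have hD : ∀ n, cell c n = D n := by
      intro n
      induction n with
      | zero => rfl
      | succ n ih =>
        rw [cell_succ, ih]
    have hx : ∀ n, x ∈ cell c n := by
      intro n
      induction n with
      | zero => trivial
      | succ n ih =>
        refine ⟨ih, ?_⟩
        change f (k (cell c n) n) x = f (k (D n) n) x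
        rw [hD]
    exact ⟨c, hsep _ _ fun n => cell_const c n _ (hφ c (n + 1)) _ (hx (n + 1))⟩
  let F : X → ℕ → Bool := fun x n => f n x
  have hF : Continuous F := continuous_pi hf
  have hFinj : Function.Injective F := fun x y h => hsep x y (congrFun h)
  have : T2Space X := T2Space.of_injective_continuous hFinj hF
  have hemb : Topology.IsClosedEmbedding F := hF.isClosedEmbedding hFinj
  have hcont : Continuous φ := by
    rw [hemb.isEmbedding.continuous_iff]
    refine continuous_pi fun n => ?_
    refine (IsLocallyConstant.iff_exists_open _).2 (fun c => ?_) |>.continuous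
    refine ⟨⋂ i ∈ Finset.range (n + 1), {c' | c' i = c i}, ?_, by simp, ?_⟩
    · refine isOpen_biInter_finset fun i _ => ?_
      exact (isOpen_discrete ({c i} : Set Bool)).preimage
        (continuous_apply (A := fun _ : ℕ => Bool) i)
    · intro c' hc'
      simp only [mem_iInter, Finset.mem_range, mem_ofPred_eq] at hc'
      have h := hφ c' (n + 1)
      rw [cell_congr c' c (n + 1) hc'] at h
      exact cell_const c n _ h _ (hφ c (n + 1))
  exact ⟨(hcont.homeoOfEquivCompactToT2 (f := Equiv.ofBijective φ ⟨hinj, hsurj⟩)).symm⟩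

/-- the boundary `∂Ω₂ = Ω̄₂ ∖ Ω₂` is homeomorphic to the Cantor
space `ℕ → Bool`. -/
theorem stmt17 :
    Nonempty (↥(OmegaBar \ (embedT '' Omega2)) ≃ₜ (ℕ → Bool)) := by
  rw [boundary_eq]
  set D : Set ((BWord → Bool) × (BWord → Bool)) := {d | IsTreePair d} ∩ {d | IsTouching d}
  have hclosed : IsClosed D := isClosed_isTreePair.inter isClosed_isTouching
  have : CompactSpace D := isCompact_iff_compactSpace.1 hclosed.isCompact
  have : Nonempty D :=
    ⟨⟨(fun _ => true, fun _ => true), ⟨by simp, by simp, by simp⟩,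
      fun n => ⟨List.replicate n true, by simp⟩⟩⟩
  obtain ⟨e, he⟩ := exists_surjective_nat (BWord ⊕ BWord)
  refine nonempty_homeomorph_cantor (fun n x => Sum.elim x.1.1 x.1.2 (e n)) ?_ ?_ ?_
  · intro n
    cases e n <;> simp only [Sum.elim_inl, Sum.elim_inr] <;> fun_prop
  · intro x y h
    have h' : ∀ s, Sum.elim x.1.1 x.1.2 s = Sum.elim y.1.1 y.1.2 s := by
      intro s
      obtain ⟨n, rfl⟩ := he s
      exact h n
    exact Subtype.ext (Prod.ext (funext fun w => h' (Sum.inl w)) (funext fun w => h' (Sum.inr w)))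
  · intro x hx
    choose s hs1 hs2 hs3 hs4 using exists_ne_agree x.2.1 x.2.2
    have hlim : Tendsto (fun n => (⟨s n, hs1 n, hs2 n⟩ : D)) atTop (𝓝 x) :=
      tendsto_subtype_rng.2 (tendsto_of_agree hs4)
    obtain ⟨n, hn⟩ := (hlim.eventually (hx.mem_nhds rfl)).exists
    exact hs3 n (congrArg Subtype.val hn)
end

section
/- Let f be an element of Thompson's group F induced by an order-preserving code J, and let ℓ(f) = max{ | |α| − |β| | : (α, β) ∈ J }. Then for all clopen subsets p, q of C, μ((f · p) Δ (f · q)) ≤ 2^(ℓ(f)+1) · μ(p Δ q), where Δ denotes symmetric difference; that is, the map p ↦ f · p is Lipschitz with constant 2^(ℓ(f)+1) with respect to the metric d_τ(p, q) = μ(p Δ q). -/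
open Set MeasureTheory Filter Topology

theorem mem_cyl_iff (w : BWord) (y : CantorC) :
    y ∈ cyl w ↔ ∀ i (h : i < w.length), y i = w[i] := by
  constructor
  · rintro ⟨x, rfl⟩ i h
    simp [wordApp, h]
  · intro h
    refine ⟨fun n => y (n + w.length), funext fun n => ?_⟩
    by_cases hn : n < w.length
    · simp [wordApp, hn, h n hn]
    · simp [wordApp, hn, Nat.sub_add_cancel (not_lt.1 hn)]

theorem mem_cyl_ofFn_iff {n : ℕ} (g : Fin n → Bool) (y : CantorC) :
    y ∈ cyl (List.ofFn g) ↔ ∀ i : Fin n, y i = g i := by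
  rw [mem_cyl_iff]
  constructor
  · intro h i
    simpa using h i (by simp)
  · intro h i hi
    simpa using h ⟨i, by simpa using hi⟩

theorem isOpen_cyl (w : BWord) : IsOpen (cyl w) := by
  have : cyl w = ⋂ i : Fin w.length, (fun y : CantorC => y i) ⁻¹' {w[i]} := by
    ext y
    simp [mem_cyl_iff, Fin.forall_iff]
  rw [this]
  exact isOpen_iInter_of_finite fun i => (isOpen_discrete _).preimage (continuous_apply _)

theorem actF_symmDiff (g : Equiv.Perm CantorC) (p q : Set CantorC) :
    symmDiff (actF g p) (actF g q) = g '' symmDiff p q := by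
  ext y
  obtain ⟨x, rfl⟩ := g.surjective y
  simp only [actF, Set.mem_symmDiff, Set.mem_union, g.injective.mem_set_image, Set.mem_inter_iff,
    Set.mem_compl_iff]
  tauto

/-- A clopen set is a union of cylinders of any fixed, sufficiently large length. -/
theorem exists_level_of_isClopen {A : Set CantorC} (hA : IsClopen A) :
    ∃ N, ∀ n ≥ N, ∀ x ∈ A, cyl (List.ofFn fun i : Fin n => x i) ⊆ A := by
  have hmono : ∀ {m n : ℕ} (x : CantorC), m ≤ n →
      cyl (List.ofFn fun i : Fin n => x i) ⊆ cyl (List.ofFn fun i : Fin m => x i) := by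
    intro m n x hmn y hy
    rw [mem_cyl_ofFn_iff] at hy ⊢
    exact fun i => hy ⟨i, i.2.trans_le hmn⟩
  let U : ℕ → Set CantorC := fun n => {x | cyl (List.ofFn fun i : Fin n => x i) ⊆ A}
  have hUmono : Monotone U := fun m n hmn x hx => (hmono x hmn).trans hx
  have hUopen : ∀ n, IsOpen (U n) := by
    intro n
    have hc : Continuous fun (x : CantorC) (i : Fin n) => x i := by fun_prop
    exact (isOpen_discrete {g : Fin n → Bool | cyl (List.ofFn g) ⊆ A}).preimage hc
  have hcov : A ⊆ ⋃ n, U n := by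
    intro x hx
    obtain ⟨ε, hε, h⟩ := PiNat.isTopologicalBasis_cylinders (fun _ => Bool)
      |>.exists_subset_of_mem_open hx hA.isOpen
    obtain ⟨z, n, rfl⟩ := hε
    refine Set.mem_iUnion.2 ⟨n, fun y hy => h.2 ?_⟩
    rw [mem_cyl_ofFn_iff] at hy
    intro i hi
    exact (hy ⟨i, hi⟩).trans (h.1 i hi)
  obtain ⟨N, hN⟩ := hA.isClosed.isCompact.elim_directed_cover U hUopen hcov hUmono.directed_le
  exact ⟨N, fun n hn x hx => hUmono hn (hN hx)⟩

/-- The image of a cylinder finer than the domain partition of the code is a cylinder. -/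
theorem IsCodeFor.exists_image_cyl {J : Finset (BWord × BWord)} {f : Equiv.Perm CantorC}
    (hJ : IsCodeFor J f) {w : BWord} (hw : ∀ r ∈ J, r.2.length ≤ w.length) :
    ∃ r ∈ J, ∃ v, w = r.2 ++ v ∧ f '' cyl w = cyl (r.1 ++ v) := by
  obtain ⟨r, ⟨hr, hx⟩, -⟩ := hJ.1.2 (wordApp w fun _ => false)
  have hpre : r.2 <+: w := by
    rw [List.prefix_iff_getElem]
    refine ⟨hw r hr, fun i hi => ?_⟩
    rw [← (mem_cyl_iff _ _).1 hx i hi,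
      (mem_cyl_iff w _).1 ⟨_, rfl⟩ i (hi.trans_le (hw r hr))]
  obtain ⟨v, rfl⟩ := hpre
  refine ⟨r, hr, v, rfl, ?_⟩
  rw [cyl, cyl, ← Set.range_comp]
  congr 1
  funext x
  simp [wordApp_append, hJ.2.2 r hr]

/-- An element of Thompson's group expands the measure of a clopen set by a factor at most
`2 ^ L`, if the code has length differences at most `L`. -/
theorem IsCodeFor.measure_image_le {μ : Measure CantorC}
    (hμ : ∀ w : BWord, μ (cyl w) = (2 : ENNReal)⁻¹ ^ w.length)
    {f : Equiv.Perm CantorC} {J : Finset (BWord × BWord)} (hJ : IsCodeFor J f)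
    {L : ℕ} (hL : ∀ r ∈ J, r.2.length ≤ r.1.length + L) {A : Set CantorC} (hA : IsClopen A) :
    μ (f '' A) ≤ 2 ^ L * μ A := by
  classical
  obtain ⟨N, hN⟩ := exists_level_of_isClopen hA
  set n := max N (J.sup fun r => r.2.length)
  let F : Finset (Fin n → Bool) := {g | cyl (List.ofFn g) ⊆ A}
  have hAF : A = ⋃ g ∈ F, cyl (List.ofFn g) := by
    refine Set.Subset.antisymm (fun x hx => ?_) (Set.iUnion₂_subset fun g hg => by simpa [F] using hg)
    refine Set.mem_iUnion₂.2 ⟨fun i => x i, ?_, (mem_cyl_ofFn_iff _ _).2 fun _ => rfl⟩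
    simpa [F] using hN n (le_max_left _ _) x hx
  have hdisj : (F : Set (Fin n → Bool)).PairwiseDisjoint fun g => cyl (List.ofFn g) := by
    intro g _ h _ hgh
    refine Set.disjoint_left.2 fun y hg hh => hgh (funext fun i => ?_)
    rw [mem_cyl_ofFn_iff] at hg hh
    rw [← hg i, hh i]
  have hcyl : ∀ g : Fin n → Bool, μ (f '' cyl (List.ofFn g)) ≤ 2 ^ L * μ (cyl (List.ofFn g)) := by
    intro g
    obtain ⟨r, hr, v, hw, him⟩ := hJ.exists_image_cyl (w := List.ofFn g) fun r hr => by
      rw [List.length_ofFn]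
      exact (Finset.le_sup (f := fun r : BWord × BWord => r.2.length) hr).trans (le_max_right _ _)
    rw [him, hw, hμ, hμ, List.length_append, List.length_append]
    have h2 : (2 : ENNReal) ^ L * 2⁻¹ ^ L = 1 := by
      rw [← mul_pow, ENNReal.mul_inv_cancel (by simp) (by simp), one_pow]
    calc (2 : ENNReal)⁻¹ ^ (r.1.length + v.length)
        = 2 ^ L * 2⁻¹ ^ (L + (r.1.length + v.length)) := by rw [pow_add _ L, ← mul_assoc, h2, one_mul]
      _ ≤ 2 ^ L * 2⁻¹ ^ (r.2.length + v.length) := by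
        gcongr 2 ^ L * ?_
        exact pow_le_pow_right_of_le_one' (by simp) (by have := hL r hr; omega)
  calc μ (f '' A) = μ (⋃ g ∈ F, f '' cyl (List.ofFn g)) := by
        conv_lhs => rw [hAF, Set.image_iUnion₂]
    _ ≤ ∑ g ∈ F, μ (f '' cyl (List.ofFn g)) := measure_biUnion_finset_le _ _
    _ ≤ ∑ g ∈ F, 2 ^ L * μ (cyl (List.ofFn g)) := Finset.sum_le_sum fun g _ => hcyl g
    _ = 2 ^ L * μ A := by
        rw [← Finset.mul_sum, ← measure_biUnion_finset hdisj fun g _ => (isOpen_cyl _).measurableSet,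
          ← hAF]

/-- if `J` is an order-preserving code for `f` and
`ℓ(f) = max{||α|−|β|| : (α,β) ∈ J}`, then `p ↦ f · p` is Lipschitz with constant
`2^(ℓ(f)+1)` for the metric `d_τ(p,q) = μ(p Δ q)` on clopen subsets, `μ` being the
uniform Bernoulli measure (characterized by `μ(C_w) = 2^(−|w|)`). -/
theorem stmt18 (μ : Measure CantorC)
    (hμ : ∀ w : BWord, μ (cyl w) = (2 : ENNReal)⁻¹ ^ w.length)
    (f : Equiv.Perm CantorC) (J : Finset (BWord × BWord)) (hJ : IsCodeFor J f)
    (L : ℕ) (hL : L = J.sup fun p => max (p.1.length - p.2.length) (p.2.length - p.1.length))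
    (p q : Set CantorC) (hp : IsClopen p) (hq : IsClopen q) :
    μ (symmDiff (actF f p) (actF f q)) ≤ 2 ^ (L + 1) * μ (symmDiff p q) := by
  rw [actF_symmDiff]
  have hpq : IsClopen (symmDiff p q) := (hp.diff hq).union (hq.diff hp)
  refine (hJ.measure_image_le (L := L) hμ (fun r hr => ?_) hpq).trans ?_
  · have := Finset.le_sup (f := fun p : BWord × BWord =>
      max (p.1.length - p.2.length) (p.2.length - p.1.length)) hr
    rw [← hL] at this
    have := (le_max_right _ _).trans this
    omega
  · gcongr
    · norm_num
    · omega
end
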